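/- The set of all (countably additive, extended-real-valued) measures on a measurable space X forms a cardinal algebra under pointwise addition, i.e., pointwise addition of measures satisfies the refinement and remainder axioms with total + and total countable sum. -/

import Mathlib

open MeasureTheory
open scoped ENNReal

namespace MeasureTheory.Measure

variable {X : Type*} [MeasurableSpace X]

/-- The supremum of `φ` over measurable subsets is a measure as soon as `φ` is countably
subadditive on disjoint sequences and superadditive up to passing to subsets. -/
theorem exists_apply_eq_iSup_subset (φ : Set X → ℝ≥0∞) (h_empty : φ ∅ = 0)
    (h_sub : ∀ f : ℕ → Set X, (∀ i, MeasurableSet (f i)) → Pairwise (Function.onFun Disjoint f) →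
      φ (⋃ i, f i) ≤ ∑' i, φ (f i))
    (h_super : ∀ A B, MeasurableSet A → MeasurableSet B → Disjoint A B →
      ∃ C, MeasurableSet C ∧ C ⊆ A ∪ B ∧ φ A + φ B ≤ φ C) :
    ∃ m : Measure X, ∀ A, MeasurableSet A →
      m A = ⨆ (B : Set X) (_ : MeasurableSet B ∧ B ⊆ A), φ B := by
  set D : Set X → ℝ≥0∞ := fun A => ⨆ (B : Set X) (_ : MeasurableSet B ∧ B ⊆ A), φ B with hD
  have le_D : ∀ {A B}, MeasurableSet B → B ⊆ A → φ B ≤ D A := fun {A B} hB h =>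
    le_iSup₂_of_le B ⟨hB, h⟩ le_rfl
  have D_mono : ∀ {A B}, B ⊆ A → D B ≤ D A := fun {A B} h =>
    iSup₂_le fun C hC => le_D hC.1 (hC.2.trans h)
  have D_add : ∀ {A B}, Disjoint A B → D A + D B ≤ D (A ∪ B) := by
    intro A B hAB
    refine ENNReal.biSup_add_biSup_le' ⟨∅, .empty, Set.empty_subset _⟩
      ⟨∅, .empty, Set.empty_subset _⟩ fun A' hA' B' hB' => ?_
    obtain ⟨C, hC, hCs, hle⟩ := h_super A' B' hA'.1 hB'.1 (hAB.mono hA'.2 hB'.2)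
    exact hle.trans (le_D hC (hCs.trans (Set.union_subset_union hA'.2 hB'.2)))
  have D_empty : D ∅ = 0 := by
    refine le_antisymm (iSup₂_le fun B hB => ?_) zero_le
    rw [Set.subset_empty_iff.1 hB.2, h_empty]
  refine ⟨ofMeasurable (fun A _ => D A) D_empty fun f hf hd => le_antisymm ?_ ?_,
    fun A hA => ofMeasurable_apply A hA⟩
  · refine iSup₂_le fun B hB => ?_
    have hBU : B = ⋃ i, B ∩ f i := by
      rw [← Set.inter_iUnion, Set.inter_eq_left.2 hB.2]
    rw [hBU]
    refine (h_sub _ (fun i => hB.1.inter (hf i)) fun i j hij =>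
      (hd hij).mono Set.inter_subset_right Set.inter_subset_right).trans ?_
    exact ENNReal.tsum_le_tsum fun i => le_D (hB.1.inter (hf i)) Set.inter_subset_right
  · rw [ENNReal.tsum_eq_iSup_nat]
    refine iSup_le fun n => ?_
    have key : ∑ i ∈ Finset.range n, D (f i) ≤ D (⋃ i ∈ Finset.range n, f i) := by
      induction n with
      | zero => simp
      | succ n ih =>
        rw [Finset.sum_range_succ, Finset.range_add_one, Finset.set_biUnion_insert, Set.union_comm]
        refine (add_le_add_left ih _).trans (D_add ?_)
        simp only [Set.disjoint_iUnion_left, Finset.mem_range]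
        exact fun i hi => hd hi.ne
    exact key.trans (D_mono (Set.iUnion₂_subset fun i _ => Set.subset_iUnion f i))

theorem exists_sub_measure (μ ν : Measure X) :
    ∃ m : Measure X, ∀ A, MeasurableSet A →
      m A = ⨆ (B : Set X) (_ : MeasurableSet B ∧ B ⊆ A), (μ B - ν B) := by
  refine exists_apply_eq_iSup_subset (fun B => μ B - ν B) (by simp) ?_ ?_
  · intro f hf hd
    rw [tsub_le_iff_right, measure_iUnion hd hf, measure_iUnion hd hf, ← ENNReal.tsum_add]
    exact ENNReal.tsum_le_tsum fun i => le_tsub_add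
  · intro A B hA hB hAB
    rcases le_total (μ A) (ν A) with h | h
    · exact ⟨B, hB, Set.subset_union_right, by simp [tsub_eq_zero_of_le h]⟩
    rcases le_total (μ B) (ν B) with h' | h'
    · exact ⟨A, hA, Set.subset_union_left, by simp [tsub_eq_zero_of_le h']⟩
    by_cases hA' : ν A = ∞
    · exact ⟨B, hB, Set.subset_union_right, by simp [hA']⟩
    by_cases hB' : ν B = ∞
    · exact ⟨A, hA, Set.subset_union_left, by simp [hB']⟩
    refine ⟨A ∪ B, hA.union hB, subset_rfl, ?_⟩
    rw [measure_union hAB hB, measure_union hAB hB]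
    refine ENNReal.le_sub_of_add_le_right (ENNReal.add_ne_top.2 ⟨hA', hB'⟩) ?_
    rw [add_add_add_comm, tsub_add_cancel_of_le h, tsub_add_cancel_of_le h']

theorem sub_apply_eq_iSup (μ ν : Measure X) {A : Set X} (hA : MeasurableSet A) :
    (μ - ν) A = ⨆ (B : Set X) (_ : MeasurableSet B ∧ B ⊆ A), (μ B - ν B) := by
  obtain ⟨m, hm⟩ := exists_sub_measure μ ν
  suffices μ - ν = m by rw [this, hm A hA]
  refine le_antisymm (sub_le_of_le_add ?_) (le_sInf fun τ hτ => le_iff.2 fun A hA => ?_)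
  · refine le_iff.2 fun A hA => ?_
    rw [add_apply, hm A hA, ← tsub_le_iff_right]
    exact le_iSup₂_of_le A ⟨hA, subset_rfl⟩ le_rfl
  · rw [hm A hA]
    refine iSup₂_le fun B hB => ?_
    rw [tsub_le_iff_right]
    exact (hτ B).trans (add_le_add_left (measure_mono hB.2) _)

instance instOrderedSub : OrderedSub (Measure X) where
  tsub_le_iff_right μ ν τ := by
    refine ⟨fun h => le_iff.2 fun A hA => ?_, sub_le_of_le_add⟩
    refine le_trans ?_ (add_le_add_left (h A) (ν A))
    rw [sub_apply_eq_iSup μ ν hA, ← tsub_le_iff_right]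
    exact le_iSup₂_of_le A ⟨hA, subset_rfl⟩ le_rfl

theorem add_sub_le_of_forall {σ τ μ ν : Measure X}
    (h : ∀ A, MeasurableSet A → σ A + (μ A - ν A) ≤ τ A) : σ + (μ - ν) ≤ τ := by
  refine le_iff.2 fun A hA => ?_
  rw [add_apply, sub_apply_eq_iSup μ ν hA]
  rw [ENNReal.add_biSup' ⟨∅, .empty, Set.empty_subset _⟩]
  refine iSup₂_le fun B hB => ?_
  rw [← measure_sdiff_add_inter (μ := σ) A hB.1, ← measure_sdiff_add_inter (μ := τ) A hB.1,
    Set.inter_eq_right.2 hB.2, add_assoc]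
  exact add_le_add (le_self_add.trans (h _ (hA.diff hB.1))) (h B hB.1)

theorem add_sub_of_le {μ ν : Measure X} (h : μ ≤ ν) : μ + (ν - μ) = ν :=
  le_antisymm (add_sub_le_of_forall fun A _ => (add_tsub_cancel_of_le (h A)).le) le_add_tsub

instance instCanonicallyOrderedAdd : CanonicallyOrderedAdd (Measure X) where
  exists_add_of_le h := ⟨_, (add_sub_of_le h).symm⟩
  le_add_self _ _ := Measure.le_add_left le_rfl
  le_self_add _ _ := Measure.le_add_right le_rfl

theorem inf_add_sub (μ ν : Measure X) : μ ⊓ ν + (μ - ν) = μ := by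
  refine le_antisymm (add_sub_le_of_forall fun A _ => ?_) ?_
  · rcases le_total (μ A) (ν A) with h | h
    · rw [tsub_eq_zero_of_le h, add_zero]
      exact (inf_le_left : μ ⊓ ν ≤ μ) A
    · exact (add_le_add_left ((inf_le_right : μ ⊓ ν ≤ ν) A) _).trans
        (add_tsub_cancel_of_le h).le
  · rw [← tsub_le_iff_right]
    exact le_inf tsub_le_self (tsub_le_iff_tsub_le.1 le_rfl)

theorem add_sup_le {σ τ μ ν : Measure X} (hμ : σ + μ ≤ τ) (hν : σ + ν ≤ τ) :
    σ + μ ⊔ ν ≤ τ := by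
  have h : μ ⊔ ν ≤ ν + (μ - ν) := sup_le le_add_tsub le_self_add
  refine (add_le_add_right h σ).trans ?_
  rw [← add_assoc]
  refine add_sub_le_of_forall fun A _ => ?_
  rw [add_apply, add_assoc]
  rcases le_total (μ A) (ν A) with h | h
  · rw [tsub_eq_zero_of_le h, add_zero]
    exact hν A
  · rw [add_tsub_cancel_of_le h]
    exact hμ A

theorem inf_add_sub_le_of_add_eq {a b c d : Measure X} (h : a + b = c + d) :
    a ⊓ c + (d - b) ≤ a := by
  refine add_sub_le_of_forall fun A _ => ?_
  rcases le_total (d A) (b A) with hA | hA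
  · rw [tsub_eq_zero_of_le hA, add_zero]
    exact (inf_le_left : a ⊓ c ≤ a) A
  · by_cases hb : b A = ∞
    · simp only [hb, ENNReal.sub_top, add_zero]
      exact (inf_le_left : a ⊓ c ≤ a) A
    have h' : a A + b A = c A + d A := by simpa using congrArg (fun m : Measure X => m A) h
    refine (add_le_add_left ((inf_le_right : a ⊓ c ≤ c) A) _).trans ?_
    rw [← ENNReal.add_le_add_iff_right hb, add_assoc, tsub_add_cancel_of_le hA, h']

theorem inf_add_sub_sup_of_add_eq {a b c d : Measure X} (h : a + b = c + d) :
    a ⊓ c + (a - c) ⊔ (d - b) = a := by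
  refine le_antisymm (add_sup_le (inf_add_sub a c).le (inf_add_sub_le_of_add_eq h)) ?_
  calc a = a ⊓ c + (a - c) := (inf_add_sub a c).symm
    _ ≤ _ := add_le_add_right le_sup_left _

theorem exists_refinement_of_add_eq_add {a b c d : Measure X} (h : a + b = c + d) :
    ∃ w x y z : Measure X, a = w + x ∧ b = y + z ∧ c = w + y ∧ d = x + z := by
  refine ⟨a ⊓ c, (a - c) ⊔ (d - b), (c - a) ⊔ (b - d), b ⊓ d,
    (inf_add_sub_sup_of_add_eq h).symm, ?_, ?_, ?_⟩
  · rw [sup_comm, add_comm]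
    exact (inf_add_sub_sup_of_add_eq (by rw [add_comm b, h, add_comm])).symm
  · rw [inf_comm]
    exact (inf_add_sub_sup_of_add_eq h.symm).symm
  · rw [sup_comm, add_comm, inf_comm]
    exact (inf_add_sub_sup_of_add_eq (by rw [add_comm d, ← h, add_comm])).symm

theorem sum_eq_zero_add (s : ℕ → Measure X) :
    sum s = s 0 + sum fun n => s (n + 1) := by
  ext A hA
  rw [add_apply, sum_apply _ hA, sum_apply _ hA]
  exact tsum_eq_zero_add' ENNReal.summable

theorem sum_apply_eq_iSup (s : ℕ → Measure X) {A : Set X} (hA : MeasurableSet A) :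
    sum s A = ⨆ n, (∑ i ∈ Finset.range n, s i) A := by
  simp only [sum_apply _ hA, ENNReal.tsum_eq_iSup_nat, finsetSum_apply]

theorem sum_le_iff {s : ℕ → Measure X} {μ : Measure X} :
    sum s ≤ μ ↔ ∀ n, ∑ i ∈ Finset.range n, s i ≤ μ := by
  refine ⟨fun h n => le_iff.2 fun A hA => ?_, fun h => le_iff.2 fun A hA => ?_⟩
  · refine le_trans ?_ (h A)
    rw [sum_apply_eq_iSup s hA]
    exact le_iSup (fun n => (∑ i ∈ Finset.range n, s i) A) n
  · rw [sum_apply_eq_iSup s hA]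
    exact iSup_le fun n => h n A

theorem sum_range_sub_of_monotone {d : ℕ → Measure X} (hd : Monotone d) (n : ℕ) :
    d 0 + ∑ i ∈ Finset.range n, (d (i + 1) - d i) = d n := by
  induction n with
  | zero => simp
  | succ n ih => rw [Finset.sum_range_succ, ← add_assoc, ih, add_sub_of_le (hd n.le_succ)]

/-- The pointwise supremum of a monotone sequence of measures is the measure obtained by summing
its increments. -/
theorem add_sum_sub_apply_of_monotone {d : ℕ → Measure X} (hd : Monotone d) {A : Set X}
    (hA : MeasurableSet A) :
    (d 0 + sum fun i => d (i + 1) - d i) A = ⨆ n, d n A := by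
  rw [add_apply, sum_apply_eq_iSup _ hA, ENNReal.add_iSup]
  refine iSup_congr fun n => ?_
  rw [← add_apply, sum_range_sub_of_monotone hd]

theorem exists_remainder {s t : ℕ → Measure X} (h : ∀ n, s n = t n + s (n + 1)) :
    ∃ c : Measure X, ∀ n, s n = c + sum fun i => t (i + n) := by
  set T : ℕ → Measure X := fun n => sum fun i => t (i + n) with hT
  have T_succ : ∀ n, T n = t n + T (n + 1) := fun n => by
    simp only [hT]
    rw [sum_eq_zero_add]
    simp only [zero_add, add_right_comm _ 1 n, add_assoc]
  have T_le : ∀ n, T n ≤ s n := by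
    refine fun n => sum_le_iff.2 fun k => ?_
    induction k generalizing n with
    | zero => simp
    | succ k ih =>
      rw [Finset.sum_range_succ', add_comm, zero_add, h n]
      refine add_le_add_right ?_ _
      simpa only [add_right_comm _ 1 n, add_assoc] using ih (n + 1)
  set d : ℕ → Measure X := fun n => s n - T n with hdef
  have d_add : ∀ n, d n + T n = s n := fun n => by rw [add_comm, add_sub_of_le (T_le n)]
  have d_mono : Monotone d := monotone_nat_of_le_succ fun n => by
    rw [hdef, tsub_le_iff_right, T_succ, h n, add_left_comm]
    exact add_le_add_right (d_add (n + 1)).ge _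
  have d_add_le : ∀ k n, d (n + k) + T n ≤ s n := by
    intro k
    induction k with
    | zero => exact fun n => (d_add n).le
    | succ k ih =>
      intro n
      rw [T_succ, h n, add_left_comm, add_comm k 1, ← add_assoc n 1 k]
      exact add_le_add_right (ih (n + 1)) _
  refine ⟨d 0 + sum fun i => d (i + 1) - d i, fun n => ?_⟩
  ext A hA
  rw [add_apply, add_sum_sub_apply_of_monotone d_mono hA, ENNReal.iSup_add]
  refine le_antisymm ?_ (iSup_le fun m => ?_)
  · exact le_iSup_of_le n (by rw [← d_add n]; rfl)
  · refine le_trans (add_le_add_left (d_mono (Nat.le_add_left m n) A) _) (d_add_le m n A)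

/-- A measure that vanishes on every set where `∑ hₙ` is finite is a sum of measures `uₙ ≤ hₙ`. -/
theorem exists_eq_sum_of_forall_eq_zero_or {p : Measure X} {h : ℕ → Measure X}
    (hp : ∀ A, MeasurableSet A → p A = 0 ∨ sum h A = ∞) :
    ∃ u : ℕ → Measure X, (∀ n, u n ≤ h n) ∧ sum u = p := by
  set H : ℕ → Measure X := fun n => ∑ i ∈ Finset.range n, h i with hH
  have H_mono : Monotone H := fun m n hmn =>
    Finset.sum_le_sum_of_subset (Finset.range_mono hmn)
  set g : ℕ → Measure X := fun n => p ⊓ H n with hg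
  have g_mono : Monotone g := fun m n hmn => inf_le_inf_left p (H_mono hmn)
  have g_zero : g 0 = 0 := by simp [hg, hH]
  set u : ℕ → Measure X := fun n => g (n + 1) - g n with hu
  have u_sum : ∀ n, ∑ i ∈ Finset.range n, u i = g n := fun n => by
    rw [← sum_range_sub_of_monotone g_mono n, g_zero, zero_add]
  refine ⟨u, fun n => ?_, ?_⟩
  · rw [hu, tsub_le_iff_left, ← tsub_le_iff_right]
    refine le_inf (tsub_le_self.trans inf_le_left) ?_
    rw [tsub_le_iff_right]
    exact inf_le_right.trans (Finset.sum_range_succ h n).le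
  have u_le : sum u ≤ p := sum_le_iff.2 fun n => (u_sum n).trans_le inf_le_left
  have g_le : ∀ n, g n ≤ sum u := fun n => (u_sum n).ge.trans (sum_le_iff.1 le_rfl n)
  refine le_antisymm u_le (le_iff.2 fun A hA => ?_)
  by_cases hfin : sum u A = ∞
  · simp [hfin]
  set r : Measure X := p - sum u with hr
  have r_add : r + sum u = p := by rw [add_comm, add_sub_of_le u_le]
  suffices hrA : r A = 0 by
    rw [← r_add, add_apply, hrA, zero_add]
  refine le_antisymm (ENNReal.le_of_forall_pos_le_add fun ε hε _ => ?_) zero_le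
  rw [zero_add]
  obtain ⟨δ, δ_pos, δ_sum⟩ := ENNReal.exists_pos_sum_of_countable
    (ENNReal.coe_pos.2 hε).ne' ℕ
  have approx : ∀ n, ∃ B, MeasurableSet B ∧ B ⊆ A ∧
      p B + H n (A \ B) ≤ g n A + δ n := by
    intro n
    have hlt : (p ⊓ H n) A < g n A + δ n :=
      ENNReal.lt_add_right (ne_top_of_le_ne_top hfin (g_le n A))
        (ENNReal.coe_pos.2 (δ_pos n)).ne'
    obtain ⟨_, ⟨t, rfl⟩, ht⟩ := sInf_lt_iff.1 ((inf_apply hA).symm.trans_lt hlt)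
    refine ⟨toMeasurable p (t ∩ A) ∩ A, (measurableSet_toMeasurable _ _).inter hA,
      Set.inter_subset_right, le_trans (add_le_add ?_ (measure_mono ?_)) ht.le⟩
    · exact (measure_mono Set.inter_subset_left).trans (measure_toMeasurable _).le
    · exact fun x hx => ⟨fun hxt => hx.2 ⟨subset_toMeasurable p _ ⟨hxt, hx.1⟩, hx.1⟩, hx.1⟩
  choose B B_meas B_sub hB using approx
  have δ_le : ∀ n, (δ n : ℝ≥0∞) ≤ ε := fun n => (ENNReal.le_tsum n).trans δ_sum.le
  have bound : ∀ n, p (B n) + H n (A \ B n) ≤ sum u A + ε := fun n =>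
    (hB n).trans (add_le_add (g_le n A) (δ_le n))
  have bound_ne : sum u A + ε ≠ ∞ := ENNReal.add_ne_top.2 ⟨hfin, ENNReal.coe_ne_top⟩
  have r_le : ∀ n, r (B n) ≤ δ n := by
    intro n
    have hH_ne : H n (A \ B n) ≠ ∞ := ne_top_of_le_ne_top bound_ne (le_add_self.trans (bound n))
    have hu_ne : sum u (B n) ≠ ∞ := ne_top_of_le_ne_top hfin (measure_mono (B_sub n))
    rw [← ENNReal.add_le_add_iff_right hu_ne, ← add_apply, r_add,
      ← ENNReal.add_le_add_iff_right hH_ne]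
    refine (hB n).trans ?_
    rw [← measure_inter_add_sdiff (μ := g n) A (B_meas n), Set.inter_eq_right.2 (B_sub n),
      add_comm, ← add_assoc]
    exact add_le_add (add_le_add_right (g_le n _) _) ((inf_le_right : g n ≤ H n) _)
  have r_compl : r (A \ ⋃ n, B n) = 0 := by
    have hmeas : MeasurableSet (A \ ⋃ n, B n) := hA.diff (.iUnion B_meas)
    refine le_antisymm ?_ zero_le
    refine ((tsub_le_self : r ≤ p) _).trans_eq ((hp _ hmeas).resolve_right ?_)
    refine ne_top_of_le_ne_top bound_ne ?_
    rw [sum_apply_eq_iSup h hmeas]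
    refine iSup_le fun n => le_trans (measure_mono ?_) (le_add_self.trans (bound n))
    exact Set.sdiff_subset_sdiff_right (Set.subset_iUnion B n)
  calc r A ≤ r ((A \ ⋃ n, B n) ∪ ⋃ n, B n) := measure_mono (by simp)
    _ ≤ r (A \ ⋃ n, B n) + r (⋃ n, B n) := measure_union_le _ _
    _ ≤ 0 + ∑' n, (δ n : ℝ≥0∞) :=
      add_le_add r_compl.le ((measure_iUnion_le _).trans (ENNReal.tsum_le_tsum r_le))
    _ ≤ ε := by rw [zero_add]; exact δ_sum.le

/-- Every measure `p` splits into a part vanishing on the sets of finite `S`-measure and a part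
concentrated on those sets. -/
theorem exists_eq_add_of_finite_sets (p S : Measure X) :
    ∃ p₁ p₂ : Measure X, p = p₁ + p₂ ∧
      (∀ A, MeasurableSet A → S A ≠ ∞ → p₁ A = 0) ∧
      ∀ A, MeasurableSet A → p₂ A ≠ 0 →
        ∃ B, MeasurableSet B ∧ B ⊆ A ∧ S B ≠ ∞ ∧ p B ≠ 0 := by
  classical
  obtain ⟨m, hm⟩ := exists_apply_eq_iSup_subset (fun B => if S B = ∞ then 0 else p B) (by simp)
    (fun f hf hd => by
      split_ifs with hS
      · exact zero_le
      rw [measure_iUnion hd hf]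
      refine ENNReal.tsum_le_tsum fun i => ?_
      rw [if_neg (ne_top_of_le_ne_top hS (measure_mono (Set.subset_iUnion f i)))])
    (fun A B hA hB hAB => by
      by_cases hSA : S A = ∞
      · exact ⟨B, hB, Set.subset_union_right, by simp [hSA]⟩
      by_cases hSB : S B = ∞
      · exact ⟨A, hA, Set.subset_union_left, by simp [hSB]⟩
      refine ⟨A ∪ B, hA.union hB, subset_rfl, ?_⟩
      rw [if_neg hSA, if_neg hSB, measure_union hAB hB, measure_union hAB hB,
        if_neg (ENNReal.add_ne_top.2 ⟨hSA, hSB⟩)])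
  have m_le : m ≤ p := le_iff.2 fun A hA => by
    rw [hm A hA]
    refine iSup₂_le fun B hB => ?_
    split_ifs
    · exact zero_le
    · exact measure_mono hB.2
  refine ⟨p - m, m, by rw [add_comm, add_sub_of_le m_le], fun A hA hS => ?_, fun A hA hne => ?_⟩
  · rw [sub_apply_eq_iSup p m hA]
    refine le_antisymm (iSup₂_le fun B hB => ?_) zero_le
    rw [tsub_le_iff_right, zero_add, hm B hB.1]
    refine le_iSup₂_of_le B ⟨hB.1, subset_rfl⟩ ?_
    rw [if_neg (ne_top_of_le_ne_top hS (measure_mono hB.2))]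
  · contrapose! hne
    rw [hm A hA]
    refine le_antisymm (iSup₂_le fun B hB => ?_) zero_le
    split_ifs with hS
    · exact le_rfl
    · exact (hne B hB.1 hB.2 hS).le

theorem add_eq_right_of_forall {p μ : Measure X}
    (h : ∀ A, MeasurableSet A → μ A ≠ ∞ → p A = 0) : p + μ = μ := by
  ext A hA
  by_cases hμ : μ A = ∞
  · simp [hμ]
  · simp [h A hA hμ]

theorem exists_half (μ : Measure X) : ∃ ν : Measure X, ν + ν = μ :=
  ⟨(2⁻¹ : ℝ≥0∞) • μ, by rw [← add_smul, ENNReal.inv_two_add_inv_two, one_smul]⟩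

/-- If `p` is absorbed by `∑ (sₙ + tₙ)`, then the terms `sₙ + tₙ` can be split anew so that the first
parts sum to `p + ∑ sₙ` and the second parts still sum to `∑ tₙ`. -/
theorem exists_absorption {p : Measure X} {s t : ℕ → Measure X}
    (hp : p + (sum s + sum t) = sum s + sum t) :
    ∃ s' t' : ℕ → Measure X, (∀ n, s' n + t' n = s n + t n) ∧
      sum s' = p + sum s ∧ sum t' = sum t := by
  obtain ⟨p₁, p₂, rfl, hp₁, hp₂⟩ := exists_eq_add_of_finite_sets p (sum s)
  have hp₂t : ∀ A, MeasurableSet A → sum t A ≠ ∞ → p₂ A = 0 := by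
    intro A hA ht
    by_contra hne
    obtain ⟨B, hB, hBA, hs, hpB⟩ := hp₂ A hA hne
    have hfin : (sum s + sum t) B ≠ ∞ := by
      rw [add_apply]
      exact ENNReal.add_ne_top.2 ⟨hs, ne_top_of_le_ne_top ht (measure_mono hBA)⟩
    refine hpB ?_
    have hB_eq : (p₁ + p₂) B + (sum s + sum t) B = 0 + (sum s + sum t) B := by
      rw [← add_apply, hp, zero_add]
    exact (ENNReal.add_left_inj hfin).1 hB_eq
  choose h hh using fun n => exists_half (t n)
  have hsum : sum t = sum h + sum h := by simp only [sum_add_sum, hh]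
  have hsum_top : ∀ A, sum h A ≠ ∞ → sum t A ≠ ∞ := fun A hfin => by
    rw [hsum, add_apply]
    exact ENNReal.add_ne_top.2 ⟨hfin, hfin⟩
  obtain ⟨u, hu, rfl⟩ := exists_eq_sum_of_forall_eq_zero_or (p := p₂) (h := h) fun A hA => by
    by_cases hfin : sum h A = ∞
    · exact Or.inr hfin
    · exact Or.inl (hp₂t A hA (hsum_top A hfin))
  have hut : ∀ n, u n + (h n + (h n - u n)) = t n := fun n => by
    rw [add_left_comm, add_sub_of_le (hu n), hh]
  refine ⟨fun n => s n + u n, fun n => h n + (h n - u n), fun n => ?_, ?_, ?_⟩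
  · rw [add_assoc, hut]
  · rw [← sum_add_sum, add_right_comm, add_eq_right_of_forall hp₁]
  · have hut_sum : sum u + sum (fun n => h n + (h n - u n)) = sum t := by
      simp only [sum_add_sum, hut]
    rw [← hut_sum]
    refine (add_eq_right_of_forall fun A hA hfin => hp₂t A hA (hsum_top A ?_)).symm
    refine ne_top_of_le_ne_top hfin ?_
    rw [← sum_add_sum]
    exact le_self_add

theorem exists_refinement {μ ν : Measure X} {c : ℕ → Measure X} (h : μ + ν = sum c) :
    ∃ s t : ℕ → Measure X, μ = sum s ∧ ν = sum t ∧ ∀ n, c n = s n + t n := by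
  set R : ℕ → Measure X := fun n => sum fun i => c (i + n) with hR
  have R_succ : ∀ n, R n = c n + R (n + 1) := fun n => by
    simp only [hR]
    rw [sum_eq_zero_add]
    simp only [zero_add, add_right_comm _ 1 n, add_assoc]
  have split : ∀ (n : ℕ) (q : {q : Measure X × Measure X // q.1 + q.2 = R n}),
      ∃ (q' : {q : Measure X × Measure X // q.1 + q.2 = R (n + 1)}) (s t : Measure X),
        q.1.1 = s + q'.1.1 ∧ q.1.2 = t + q'.1.2 ∧ c n = s + t := by
    rintro n ⟨⟨a, b⟩, hab⟩
    obtain ⟨w, x, y, z, ha, hb, hc, hd⟩ := exists_refinement_of_add_eq_add (hab.trans (R_succ n))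
    exact ⟨⟨(x, z), hd.symm⟩, w, y, ha, hb, hc⟩
  choose next s t hs ht hc using split
  let q : ∀ n, {q : Measure X × Measure X // q.1 + q.2 = R n} :=
    fun n => Nat.rec ⟨(μ, ν), h⟩ next n
  obtain ⟨a, ha⟩ := exists_remainder (s := fun n => (q n).1.1) (t := fun n => s n (q n))
    fun n => hs n (q n)
  obtain ⟨b, hb⟩ := exists_remainder (s := fun n => (q n).1.2) (t := fun n => t n (q n))
    fun n => ht n (q n)
  have hμ : μ = a + sum fun n => s n (q n) := ha 0
  have hν : ν = b + sum fun n => t n (q n) := hb 0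
  set S := sum fun n => s n (q n) with hS
  set T := sum fun n => t n (q n) with hT
  have hc_sum : sum c = S + T := by
    rw [hS, hT, sum_add_sum]
    exact congrArg sum (funext fun n => hc n (q n))
  have hab : a + b + (S + T) = S + T := by
    rw [add_add_add_comm, ← hμ, ← hν, h, hc_sum]
  have ha' : a + (S + T) = S + T :=
    le_antisymm ((add_le_add_left le_self_add _).trans hab.le) le_add_self
  have hb' : b + (T + S) = T + S := by
    rw [add_comm T S]
    exact le_antisymm ((add_le_add_left le_add_self _).trans hab.le) le_add_self
  obtain ⟨s₁, t₁, hst₁, hs₁, ht₁⟩ := exists_absorption ha'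
  obtain ⟨t₂, s₂, hst₂, ht₂, hs₂⟩ := exists_absorption (p := b) (s := t₁) (t := s₁) (by
    rw [hs₁, ht₁, add_left_comm T, add_left_comm b, hb'])
  refine ⟨s₂, t₂, ?_, ?_, fun n => ?_⟩
  · rw [hs₂, hs₁, hμ]
  · rw [ht₂, ht₁, hν]
  · rw [add_comm, hst₂, add_comm, hst₁]
    exact hc n (q n)

end MeasureTheory.Measure

/-- The set of (countably additive, `[0,∞]`-valued) measures on a measurable
space `X` forms a cardinal algebra under pointwise addition: the total binary
addition and total countable sum of measures satisfy Tarski's axioms, in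
particular the refinement and remainder axioms. -/
theorem measures_cardinalAlgebra {X : Type*} [MeasurableSpace X] :
    -- axiom 1: ∑ₙ sₙ = s₀ + ∑ₙ s_{n+1}
    (∀ s : ℕ → Measure X, Measure.sum s = s 0 + Measure.sum (fun n => s (n + 1))) ∧
    -- axiom 2: ∑ₙ (sₙ + tₙ) = ∑ₙ sₙ + ∑ₙ tₙ
    (∀ s t : ℕ → Measure X,
      Measure.sum (fun n => s n + t n) = Measure.sum s + Measure.sum t) ∧
    -- axiom 3: identity
    (∀ μ : Measure X, μ + 0 = μ ∧ 0 + μ = μ) ∧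
    -- axiom 4: refinement
    (∀ (μ ν : Measure X) (c : ℕ → Measure X), μ + ν = Measure.sum c →
      ∃ s t : ℕ → Measure X, μ = Measure.sum s ∧ ν = Measure.sum t ∧
        ∀ n, c n = s n + t n) ∧
    -- axiom 5: remainder
    (∀ s t : ℕ → Measure X, (∀ n, s n = t n + s (n + 1)) →
      ∃ c : Measure X, ∀ n, s n = c + Measure.sum (fun i => t (i + n))) := by
  refine ⟨Measure.sum_eq_zero_add, fun s t => (Measure.sum_add_sum s t).symm,
    fun μ => ⟨add_zero μ, zero_add μ⟩, fun _ _ _ => Measure.exists_refinement,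
    fun _ _ => Measure.exists_remainder⟩
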